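/- Let s ≥ 0 be an integer. Suppose (p₀,p₁,p₂,p₃) is a piecewise polynomial vector field of degree ≤ s on the Alfeld split T^z of a tetrahedron T ⊂ ℝ³ such that: (i) its normal component is single-valued across interior faces ((p_i − p_j) · n_{ij} = 0 at every point of F_{ij} for all i ≠ j); (ii) it is continuous at every vertex of T^z (p_i(a) = p_j(a) for every a ∈ {x₀,x₁,x₂,x₃,z} and all i, j with a ∈ T_i ∩ T_j); and (iii) div p_i = 0 identically for each i. Then there exists a piecewise polynomial vector field (q₀,q₁,q₂,q₃) of degree ≤ s+1 on T^z which is continuous across interior faces (q_i = q_j on F_{ij} for all i ≠ j), is C¹ at every vertex of T^z (Dq_i(a) = Dq_j(a) for every vertex a ∈ {x₀,x₁,x₂,x₃,z} and all i, j with a ∈ T_i ∩ T_j), and satisfies curl q_i = p_i for each i. -/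

import Mathlib

open MvPolynomial Matrix

noncomputable section

namespace Alfeld

abbrev V3 : Type := Fin 3 → ℝ
abbrev P3 : Type := MvPolynomial (Fin 3) ℝ
abbrev VP3 : Type := Fin 3 → P3

/-- Cross product of vectors in `ℝ³`. -/
def cross3 (u v : V3) : V3 := fun c => u (c + 1) * v (c + 2) - u (c + 2) * v (c + 1)

/-- Evaluation of a polynomial vector field at a point. -/
def evalV (p : VP3) (y : V3) : V3 := fun c => eval y (p c)

/-- Gradient of a polynomial. -/
def pgrad (q : P3) : VP3 := fun c => pderiv c q

/-- Curl of a polynomial vector field. -/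
def pcurl (p : VP3) : VP3 := fun c => pderiv (c + 1) (p (c + 2)) - pderiv (c + 2) (p (c + 1))

/-- Divergence of a polynomial vector field. -/
def pdiv (p : VP3) : P3 := ∑ c, pderiv c (p c)

/-- Cross product of polynomial vector fields. -/
def pcross (u v : VP3) : VP3 := fun c => u (c + 1) * v (c + 2) - u (c + 2) * v (c + 1)

/-- All components have total degree at most `r`. -/
def degVle (p : VP3) (r : ℕ) : Prop := ∀ c, (p c).totalDegree ≤ r

/-- Barycenter of the tetrahedron with vertices `x 0, x 1, x 2, x 3`. -/
def bary (x : Fin 4 → V3) : V3 := (4 : ℝ)⁻¹ • (x 0 + x 1 + x 2 + x 3)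

/-- The piece `T_i` of the Alfeld split. -/
def piece (x : Fin 4 → V3) (i : Fin 4) : Set V3 :=
  convexHull ℝ (insert (bary x) (x '' {j | j ≠ i}))

/-- The interior face `F_{ij} = T_i ∩ T_j`. -/
def intFace (x : Fin 4 → V3) (i j : Fin 4) : Set V3 :=
  convexHull ℝ (insert (bary x) (x '' {k | k ≠ i ∧ k ≠ j}))

/-- The boundary face of `T` opposite the vertex `x i`. -/
def bdryFace (x : Fin 4 → V3) (i : Fin 4) : Set V3 :=
  convexHull ℝ (x '' {j | j ≠ i})

/-- `n` is a (Euclidean) unit normal of the interior face `F_{ij}`. -/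
def IsUnitNormalInt (x : Fin 4 → V3) (i j : Fin 4) (n : V3) : Prop :=
  n ⬝ᵥ n = 1 ∧ ∀ k, k ≠ i → k ≠ j → n ⬝ᵥ (x k - bary x) = 0

/-- `n` is a (Euclidean) unit normal of the boundary face `F_i`. -/
def IsUnitNormalBdry (x : Fin 4 → V3) (i : Fin 4) (n : V3) : Prop :=
  n ⬝ᵥ n = 1 ∧ ∀ j k, j ≠ i → k ≠ i → n ⬝ᵥ (x k - x j) = 0

/-- The vertices of the Alfeld split. -/
def vertices (x : Fin 4 → V3) : Set V3 := insert (bary x) (Set.range x)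

/-- Jacobian matrix of a polynomial vector field at a point. -/
def jacob (p : VP3) (a : V3) : Fin 3 → Fin 3 → ℝ := fun c d => eval a (pderiv d (p c))

section PolynomialLemmas

variable {σ τ : Type*}

theorem _root_.MvPolynomial.derivation_aeval [Fintype σ] {A : Type*} [CommRing A] [Algebra ℝ A]
    (D : Derivation ℝ A A) (g : σ → A) (f : MvPolynomial σ ℝ) :
    D (aeval g f) = ∑ k, aeval g (pderiv k f) * D (g k) := by
  classical
  induction f using MvPolynomial.induction_on with
  | C r => simp
  | add f₁ f₂ h₁ h₂ => simp [h₁, h₂, add_mul, Finset.sum_add_distrib]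
  | mul_X f j h =>
    simp only [map_mul, aeval_X, Derivation.leibniz, h, smul_eq_mul, pderiv_X, map_add, add_mul,
      Finset.sum_add_distrib, Finset.mul_sum]
    congr 1
    · rw [Finset.sum_eq_single j]
      · simp
      · intro b _ hb
        simp [Pi.single_eq_of_ne (Ne.symm hb)]
      · simp
    · exact Finset.sum_congr rfl fun k _ => by ring

theorem _root_.MvPolynomial.pderiv_pderiv_comm (i j : σ) (f : MvPolynomial σ ℝ) :
    pderiv i (pderiv j f) = pderiv j (pderiv i f) := by
  classical
  let D (k : σ) : Derivation ℝ (MvPolynomial σ ℝ) (MvPolynomial σ ℝ) := pderiv k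
  have h : ⁅D i, D j⁆ = 0 := by
    refine derivation_ext fun k => ?_
    rw [Derivation.commutator_apply]
    simp only [D, pderiv_X, Pi.single_apply]
    split_ifs <;> simp
  have := congrArg (fun D => D f) h
  simpa [Derivation.commutator_apply, sub_eq_zero] using this

theorem _root_.MvPolynomial.totalDegree_pderiv_le (i : σ) (f : MvPolynomial σ ℝ) :
    (pderiv i f).totalDegree ≤ f.totalDegree - 1 := by
  classical
  refine Finset.sup_le fun m hm => ?_
  have hc : coeff (m + Finsupp.single i 1) f ≠ 0 := by
    rw [mem_support_iff, coeff_pderiv] at hm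
    exact fun h => hm (by rw [h]; simp)
  have := le_totalDegree (mem_support_iff.2 hc)
  rw [Finsupp.sum_add_index' (by simp) (by simp), Finsupp.sum_single_index rfl] at this
  omega

theorem _root_.MvPolynomial.totalDegree_aeval_le (g : σ → MvPolynomial τ ℝ)
    (hg : ∀ k, (g k).totalDegree ≤ 1) (f : MvPolynomial σ ℝ) :
    (aeval g f).totalDegree ≤ f.totalDegree := by
  rw [aeval_def, eval₂_eq]
  refine totalDegree_finsetSum_le fun m hm => ?_
  refine (totalDegree_mul _ _).trans ?_
  rw [algebraMap_eq, totalDegree_C, zero_add]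
  refine (totalDegree_finsetProd _ _).trans ((Finset.sum_le_sum fun k _ => ?_).trans
    (le_totalDegree hm))
  exact (totalDegree_pow _ _).trans (by simpa using Nat.mul_le_mul_left (m k) (hg k))

/-- The derivation `∑ₖ ∂ₖ` is surjective, with control of the degree. -/
theorem _root_.MvPolynomial.exists_sum_pderiv_eq [Fintype σ] (k₀ : σ) (d : ℕ) :
    ∀ (f : MvPolynomial σ ℝ) (j : ℕ), f.totalDegree ≤ d →
      ∃ F : MvPolynomial σ ℝ, F.totalDegree ≤ d + j + 1 ∧ ∑ k, pderiv k F = X k₀ ^ j * f := by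
  classical
  have hpow : ∀ (j : ℕ) (f : MvPolynomial σ ℝ),
      ∑ k, pderiv k (C ((j + 1 : ℝ)⁻¹) * (X k₀ ^ (j + 1) * f)) =
        X k₀ ^ j * f + X k₀ ^ (j + 1) * (C ((j + 1 : ℝ)⁻¹) * ∑ k, pderiv k f) := by
    intro j f
    have hj : (C ((j + 1 : ℝ)⁻¹) : MvPolynomial σ ℝ) * ((j : MvPolynomial σ ℝ) + 1) = 1 := by
      rw [← C_1, ← map_natCast (C : ℝ →+* MvPolynomial σ ℝ), ← C_add, ← C_mul,
        inv_mul_cancel₀ (by positivity)]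
    have hX : ∀ k, pderiv k (C ((j + 1 : ℝ)⁻¹) * (X k₀ ^ (j + 1) * f)) =
        (if k = k₀ then X k₀ ^ j * f else 0) +
          X k₀ ^ (j + 1) * (C ((j + 1 : ℝ)⁻¹) * pderiv k f) := by
      intro k
      rw [pderiv_C_mul, pderiv_mul, pderiv_pow, pderiv_X]
      by_cases hk : k = k₀
      · subst hk
        simp only [Pi.single_eq_same, if_true]
        push_cast
        linear_combination (X k ^ j * f) * hj
      · rw [Pi.single_eq_of_ne (Ne.symm hk), if_neg hk]
        ring
    simp [hX, Finset.sum_add_distrib, Finset.mul_sum]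
  have hdegX : ∀ (j e : ℕ) (f : MvPolynomial σ ℝ), f.totalDegree ≤ e →
      (C ((j + 1 : ℝ)⁻¹) * (X k₀ ^ (j + 1) * f)).totalDegree ≤ e + j + 1 := by
    intro j e f hf
    refine (totalDegree_mul _ _).trans ?_
    rw [totalDegree_C, zero_add]
    refine (totalDegree_mul _ _).trans ?_
    rw [totalDegree_X_pow]
    omega
  induction d with
  | zero =>
    intro f j hf
    refine ⟨C ((j + 1 : ℝ)⁻¹) * (X k₀ ^ (j + 1) * f), hdegX j 0 f hf, ?_⟩
    rw [hpow, totalDegree_eq_zero_iff_eq_C.1 (Nat.le_zero.1 hf)]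
    simp
  | succ d ih =>
    intro f j hf
    have hD : (C ((j + 1 : ℝ)⁻¹) * ∑ k, pderiv k f).totalDegree ≤ d := by
      refine (totalDegree_mul _ _).trans ?_
      rw [totalDegree_C, zero_add]
      exact totalDegree_finsetSum_le fun k _ => (totalDegree_pderiv_le k f).trans (by omega)
    obtain ⟨F, hF, hF'⟩ := ih _ (j + 1) hD
    refine ⟨C ((j + 1 : ℝ)⁻¹) * (X k₀ ^ (j + 1) * f) - F, ?_, ?_⟩
    · refine (totalDegree_sub _ _).trans (max_le (hdegX j _ f hf) (hF.trans (by omega)))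
    · simp only [map_sub, Finset.sum_sub_distrib, hpow, hF']
      ring

theorem _root_.MvPolynomial.homogeneousComponent_pderiv (i : σ) (r : ℕ) (f : MvPolynomial σ ℝ) :
    homogeneousComponent r (pderiv i f) = pderiv i (homogeneousComponent (r + 1) f) := by
  classical
  ext m
  rw [coeff_homogeneousComponent, coeff_pderiv, coeff_pderiv, coeff_homogeneousComponent]
  simp [map_add, Finsupp.degree_single]

theorem _root_.MvPolynomial.IsHomogeneous.eval_smul {f : MvPolynomial σ ℝ} {r : ℕ}
    (hf : f.IsHomogeneous r) (t : ℝ) (w : σ → ℝ) : eval (t • w) f = t ^ r * eval w f := by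
  rw [eval_eq, eval_eq, Finset.mul_sum]
  refine Finset.sum_congr rfl fun m hm => ?_
  have h := hf.degree_eq_sum_deg_support hm
  simp only [Pi.smul_apply, smul_eq_mul, mul_pow, Finset.prod_mul_distrib,
    Finset.prod_pow_eq_pow_sum, ← h]
  ring

/-- The restriction of a polynomial to the line `t ↦ a + t v`. -/
def onLine (a v : σ → ℝ) : MvPolynomial σ ℝ →ₐ[ℝ] Polynomial ℝ :=
  aeval fun c => Polynomial.C (a c) + Polynomial.C (v c) * Polynomial.X

theorem eval_onLine (a v : σ → ℝ) (f : MvPolynomial σ ℝ) (t : ℝ) :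
    (onLine a v f).eval t = eval (a + t • v) f := by
  unfold onLine
  induction f using MvPolynomial.induction_on with
  | C r => simp
  | add f₁ f₂ h₁ h₂ => simp [h₁, h₂]
  | mul_X f c ih => simp [ih, mul_comm t]

theorem onLine_eq_zero {f : MvPolynomial σ ℝ} {a v : σ → ℝ} {S : Set ℝ}
    (hS : S.Infinite) (h : ∀ t ∈ S, eval (a + t • v) f = 0) : onLine a v f = 0 :=
  Polynomial.eq_zero_of_infinite_isRoot _
    (hS.mono fun t ht => (eval_onLine a v f t).trans (h t ht))

/-- A polynomial that vanishes at infinitely many points of a line vanishes on the line. -/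
theorem eval_line_eq_zero {f : MvPolynomial σ ℝ} {a v : σ → ℝ} {S : Set ℝ}
    (hS : S.Infinite) (h : ∀ t ∈ S, eval (a + t • v) f = 0) (t : ℝ) : eval (a + t • v) f = 0 := by
  rw [← eval_onLine, onLine_eq_zero hS h, Polynomial.eval_zero]

/-- If a polynomial vanishes on a line, then so does its derivative along the line. -/
theorem sum_eval_pderiv_mul_eq_zero [Fintype σ] {f : MvPolynomial σ ℝ} {a v : σ → ℝ}
    (h : ∀ t : ℝ, eval (a + t • v) f = 0) : ∑ c, eval a (pderiv c f) * v c = 0 := by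
  have h0 : onLine a v f = 0 := onLine_eq_zero Set.infinite_univ fun t _ => h t
  have h1 := derivation_aeval (Polynomial.derivative' (R := ℝ))
    (fun c => Polynomial.C (a c) + Polynomial.C (v c) * Polynomial.X) f
  change Polynomial.derivative' (onLine a v f) = ∑ c, onLine a v (pderiv c f) * _ at h1
  rw [h0, map_zero] at h1
  have h2 := congrArg (Polynomial.eval 0) h1
  simpa [Polynomial.eval_finsetSum, eval_onLine, Polynomial.derivative'] using h2.symm

end PolynomialLemmas

section Potential

theorem pcurl_pcross_X (f : VP3) (c : Fin 3) :
    pcurl (pcross f X) c = 2 * f c - X c * pdiv f + ∑ d, X d * pderiv d (f c) := by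
  fin_cases c <;>
  · simp [pcurl, pcross, pdiv, pderiv_X, Fin.sum_univ_three]
    ring

/-- Multiply each homogeneous component of degree `r ≤ s` by `1 / (r + 2)`. -/
def rescale (s : ℕ) : P3 →ₗ[ℝ] P3 :=
  ∑ r ∈ Finset.range (s + 1), ((r : ℝ) + 2)⁻¹ • homogeneousComponent r

theorem rescale_apply (s : ℕ) (f : P3) :
    rescale s f = ∑ r ∈ Finset.range (s + 1), ((r : ℝ) + 2)⁻¹ • homogeneousComponent r f := by
  simp [rescale]

theorem sum_homogeneousComponent_of_le {s : ℕ} {f : P3} (hf : f.totalDegree ≤ s) :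
    ∑ r ∈ Finset.range (s + 1), homogeneousComponent r f = f := by
  conv_rhs => rw [← sum_homogeneousComponent f]
  refine (Finset.sum_subset (Finset.range_subset_range.2 (by omega)) fun r _ hr => ?_).symm
  exact homogeneousComponent_eq_zero _ _ (not_lt.1 fun h => hr (Finset.mem_range.2 h))

theorem totalDegree_rescale_le (s : ℕ) (f : P3) : (rescale s f).totalDegree ≤ s := by
  rw [rescale_apply]
  refine totalDegree_finsetSum_le fun r hr => (totalDegree_smul_le _ _).trans ?_
  exact (homogeneousComponent_isHomogeneous r f).totalDegree_le.trans
    (Nat.lt_succ_iff.1 (Finset.mem_range.1 hr))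

theorem pdiv_rescale {s : ℕ} {p : VP3} (hp : pdiv p = 0) :
    pdiv (fun c => rescale s (p c)) = 0 := by
  have h : ∀ r, ∑ c, pderiv c (homogeneousComponent r (p c)) = 0 := by
    intro r
    cases r with
    | zero => simp
    | succ r =>
      simp only [← homogeneousComponent_pderiv, ← map_sum]
      exact (congrArg _ hp).trans (map_zero _)
  simp only [pdiv, rescale_apply, map_sum, Derivation.map_smul]
  rw [Finset.sum_comm]
  exact Finset.sum_eq_zero fun r _ => by rw [← Finset.smul_sum, h, smul_zero]

theorem sum_X_mul_pderiv_rescale {s : ℕ} {f : P3} (hf : f.totalDegree ≤ s) :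
    2 * rescale s f + ∑ d, X d * pderiv d (rescale s f) = f := by
  conv_rhs => rw [← sum_homogeneousComponent_of_le hf]
  simp only [rescale_apply, map_sum, Derivation.map_smul, Finset.mul_sum, mul_smul_comm]
  rw [Finset.sum_comm, ← Finset.sum_add_distrib]
  refine Finset.sum_congr rfl fun r _ => ?_
  rw [← Finset.smul_sum, (homogeneousComponent_isHomogeneous r f).sum_X_mul_pderiv, ← smul_add,
    nsmul_eq_mul, ← add_mul, smul_eq_C_mul, ← mul_assoc]
  have : (C ((r + 2 : ℝ)⁻¹) : P3) * (2 + (r : P3)) = 1 := by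
    rw [← C_1, ← map_natCast (C : ℝ →+* P3), ← map_ofNat (C : ℝ →+* P3), ← C_add, ← C_mul,
      add_comm (2 : ℝ), inv_mul_cancel₀ (by positivity)]
  rw [this, one_mul]

/-- A vector potential of a divergence free field. -/
def potential (s : ℕ) (p : VP3) : VP3 := pcross (fun c => rescale s (p c)) X

theorem pcurl_potential {s : ℕ} {p : VP3} (hdeg : degVle p s) (hp : pdiv p = 0) :
    pcurl (potential s p) = p := by
  funext c
  rw [potential, pcurl_pcross_X, pdiv_rescale hp, mul_zero, sub_zero,
    sum_X_mul_pderiv_rescale (hdeg c)]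

theorem degVle_potential (s : ℕ) (p : VP3) : degVle (potential s p) (s + 1) := by
  intro c
  have h : ∀ a b : Fin 3, (rescale s (p a) * X b).totalDegree ≤ s + 1 := fun a b =>
    (totalDegree_mul _ _).trans
      (Nat.add_le_add (totalDegree_rescale_le s _) (totalDegree_X (R := ℝ) b).le)
  exact (totalDegree_sub _ _).trans (max_le (h _ _) (h _ _))

theorem eval_homogeneousComponent_eq_zero {f : P3} {w : V3} (h : ∀ t : ℝ, eval (t • w) f = 0)
    (r : ℕ) : eval w (homogeneousComponent r f) = 0 := by
  by_cases hr : f.totalDegree < r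
  · rw [homogeneousComponent_eq_zero _ _ hr, map_zero]
  set P : Polynomial ℝ := ∑ k ∈ Finset.range (f.totalDegree + 1),
    Polynomial.C (eval w (homogeneousComponent k f)) * Polynomial.X ^ k with hP
  have hP0 : P = 0 := by
    refine Polynomial.funext fun t => ?_
    rw [Polynomial.eval_zero, ← h t]
    conv_rhs => rw [← sum_homogeneousComponent f]
    rw [map_sum, hP, Polynomial.eval_finsetSum]
    refine Finset.sum_congr rfl fun k _ => ?_
    rw [(homogeneousComponent_isHomogeneous k f).eval_smul]
    rw [Polynomial.eval_mul, Polynomial.eval_C, Polynomial.eval_pow, Polynomial.eval_X, mul_comm]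
  have := congrArg (fun Q => Polynomial.coeff Q r) hP0
  simp only [hP, Polynomial.finsetSum_coeff, Polynomial.coeff_C_mul_X_pow, Polynomial.coeff_zero,
    Finset.sum_ite_eq, Finset.mem_range] at this
  rwa [if_pos (by omega)] at this

theorem eval_rescale_eq_zero (s : ℕ) {f : P3} {w : V3} (h : ∀ t : ℝ, eval (t • w) f = 0) :
    eval w (rescale s f) = 0 := by
  simp [rescale_apply, map_sum, smul_eval, eval_homogeneousComponent_eq_zero h]

/-- The jump of the potentials over a plane through the origin that contains `w` and `u` has no
component along `u`. -/
theorem potential_sub_dotProduct (s : ℕ) (p p' : VP3) (w u : V3)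
    (h : ∀ t : ℝ, (evalV p (t • w) - evalV p' (t • w)) ⬝ᵥ cross3 w u = 0) :
    (evalV (potential s p) w - evalV (potential s p') w) ⬝ᵥ u = 0 := by
  have key := eval_rescale_eq_zero s (f := ∑ c, cross3 w u c • (p c - p' c)) (w := w) fun t => by
    rw [← h t]
    simp only [map_sum, smul_eval, map_sub, dotProduct, evalV, Pi.sub_apply]
    exact Finset.sum_congr rfl fun c _ => mul_comm _ _
  simp [dotProduct, Fin.sum_univ_three, evalV, potential, pcross, cross3] at key ⊢
  linear_combination key

end Potential

section Gluing

/-- Set the variables in `S` to zero. -/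
def killVars (S : Finset (Fin 4)) : MvPolynomial (Fin 4) ℝ →ₐ[ℝ] MvPolynomial (Fin 4) ℝ :=
  aeval fun k => if k ∈ S then 0 else X k

theorem eval_killVars (S : Finset (Fin 4)) (f : MvPolynomial (Fin 4) ℝ) (t : Fin 4 → ℝ) :
    eval t (killVars S f) = eval (fun k => if k ∈ S then 0 else t k) f := by
  unfold killVars
  induction f using MvPolynomial.induction_on with
  | C r => simp
  | add f₁ f₂ h₁ h₂ => rw [map_add, map_add, map_add, h₁, h₂]
  | mul_X f c ih =>
    simp only [map_mul, ih, aeval_X, eval_X]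
    split_ifs <;> simp

theorem totalDegree_killVars_le (S : Finset (Fin 4)) (f : MvPolynomial (Fin 4) ℝ) :
    (killVars S f).totalDegree ≤ f.totalDegree :=
  totalDegree_aeval_le _ (fun k => by split_ifs <;> simp) f

theorem exists_complement_pair {i j : Fin 4} (h : i ≠ j) :
    ∃ k l : Fin 4, k ≠ l ∧ i ≠ k ∧ i ≠ l ∧ j ≠ k ∧ j ≠ l ∧
      (Finset.univ : Finset (Fin 4)) = {i, j, k, l} := by
  revert i j
  decide

/-- Polynomials on the coordinate planes that agree on the coordinate axes and vanish at the origin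
extend to a common polynomial. -/
theorem exists_glued (d : ℕ) (G : Fin 4 → Fin 4 → MvPolynomial (Fin 4) ℝ)
    (hdeg : ∀ i j, (G i j).totalDegree ≤ d)
    (hsymm : ∀ i j, i ≠ j → ∀ t : Fin 4 → ℝ, t i = 0 → t j = 0 → eval t (G i j) = eval t (G j i))
    (hray : ∀ (k : Fin 4) (r : ℝ) (i j i' j' : Fin 4), i ≠ k → j ≠ k → i' ≠ k → j' ≠ k → i ≠ j →
      i' ≠ j' → eval (Pi.single k r) (G i j) = eval (Pi.single k r) (G i' j'))
    (hzero : ∀ i j, eval 0 (G i j) = 0) :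
    ∃ Ψ : MvPolynomial (Fin 4) ℝ, Ψ.totalDegree ≤ d ∧
      ∀ i j, i ≠ j → ∀ t : Fin 4 → ℝ, t i = 0 → t j = 0 → eval t Ψ = eval t (G i j) := by
  have hCmul : ∀ (r : ℝ) (f : MvPolynomial (Fin 4) ℝ), f.totalDegree ≤ d →
      (C r * f).totalDegree ≤ d := fun r f hf =>
    (totalDegree_mul _ _).trans (by rw [totalDegree_C, zero_add]; exact hf)
  refine ⟨(∑ a, ∑ b, if a = b then 0 else C (1 / 2) * killVars {a, b} (G a b)) -
    ∑ k, C 2 * killVars (Finset.univ.erase k) (G (k + 1) (k + 2)), ?_, ?_⟩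
  · refine (totalDegree_sub _ _).trans (max_le ?_ ?_)
    · refine totalDegree_finsetSum_le fun a _ => totalDegree_finsetSum_le fun b _ => ?_
      split_ifs
      · simp
      · exact hCmul _ _ ((totalDegree_killVars_le _ _).trans (hdeg a b))
    · exact totalDegree_finsetSum_le fun k _ =>
        hCmul _ _ ((totalDegree_killVars_le _ _).trans (hdeg _ _))
  · intro i j hij t hi hj
    obtain ⟨k, l, hkl, hik, hil, hjk, hjl, huniv⟩ := exists_complement_pair hij
    have hsum : ∀ f : Fin 4 → ℝ, ∑ a, f a = f i + f j + f k + f l := by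
      intro f
      rw [huniv, Finset.sum_insert (by simp [*]), Finset.sum_insert (by simp [*]),
        Finset.sum_insert (by simp [*]), Finset.sum_singleton]
      ring
    have hmem : ∀ c : Fin 4, c = i ∨ c = j ∨ c = k ∨ c = l := by
      intro c
      simpa [huniv] using Finset.mem_univ c
    set A : Fin 4 → Fin 4 → ℝ := fun a b => eval t (killVars {a, b} (G a b)) with hA
    set B : Fin 4 → ℝ := fun c => eval t (killVars (Finset.univ.erase c) (G (c + 1) (c + 2)))
      with hB
    have hplane : (fun c => if c ∈ ({i, j} : Finset (Fin 4)) then 0 else t c) = t := by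
      funext c
      by_cases h : c = i ∨ c = j
      · rcases h with rfl | rfl <;> simp [hi, hj]
      · simp [h]
    have hAij : A i j = eval t (G i j) := by
      simp only [hA, eval_killVars, hplane]
    have hAji : A j i = eval t (G i j) := by
      simp only [hA, eval_killVars, Finset.pair_comm j i, hplane]
      exact (hsymm i j hij t hi hj).symm
    have hAkl : (fun c => if c ∈ ({k, l} : Finset (Fin 4)) then 0 else t c) = 0 := by
      funext c
      rcases hmem c with rfl | rfl | rfl | rfl <;> simp [*]
    have hA1 : A k l = 0 := by simp only [hA, eval_killVars, hAkl, hzero]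
    have hA2 : A l k = 0 := by
      simp only [hA, eval_killVars, Finset.pair_comm l k, hAkl, hzero]
    have hBray : ∀ c, (fun b => if b ∈ Finset.univ.erase c then 0 else t b) =
        Pi.single c (t c) := by
      intro c
      funext b
      by_cases h : b = c
      · subst h; simp
      · simp [h]
    have hB' : ∀ c, B c = eval (Pi.single c (t c)) (G (c + 1) (c + 2)) := by
      intro c
      simp only [hB, eval_killVars, hBray]
    have hBi : B i = 0 := by rw [hB', hi, Pi.single_zero, hzero]
    have hBj : B j = 0 := by rw [hB', hj, Pi.single_zero, hzero]
    have haxis : ∀ a b c, a ≠ b → a ≠ c → b ≠ c →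
        (k = a ∨ k = b ∨ k = c) → (l = a ∨ l = b ∨ l = c) → A a b = B c := by
      intro a b c hab hac hbc hk hl
      have : (fun e => if e ∈ ({a, b} : Finset (Fin 4)) then 0 else t e) = Pi.single c (t c) := by
        funext e
        by_cases hec : e = c
        · subst hec; simp [hac.symm, hbc.symm]
        · rw [Pi.single_eq_of_ne hec]
          by_cases heab : e = a ∨ e = b
          · simp [heab]
          · rcases hmem e with rfl | rfl | rfl | rfl
            · simp [hi]
            · simp [hj]
            · exact absurd hk (by tauto)
            · exact absurd hl (by tauto)
      simp only [hA, eval_killVars, hB', this]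
      refine hray c (t c) a b _ _ hac hbc ?_ ?_ hab ?_
      all_goals clear * -; revert c; decide
    simp only [map_sub, map_sum, apply_ite (eval t), map_mul, map_zero, eval_C]
    change (∑ a, ∑ b, if a = b then 0 else 1 / 2 * A a b) - ∑ c, 2 * B c = _
    simp only [hsum, hAij, hAji, hA1, hA2, hBi, hBj, hij, hij.symm, hik, hik.symm, hil, hil.symm,
      hjk, hjk.symm, hjl, hjl.symm, hkl, hkl.symm, if_true, if_false]
    rw [haxis i k l hik hil hkl (by simp) (by simp), haxis k i l hik.symm hkl hil (by simp) (by simp),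
      haxis j k l hjk hjl hkl (by simp) (by simp), haxis k j l hjk.symm hkl hjl (by simp) (by simp),
      haxis i l k hil hik hkl.symm (by simp) (by simp),
      haxis l i k hil.symm hkl.symm hik (by simp) (by simp),
      haxis j l k hjl hjk hkl.symm (by simp) (by simp),
      haxis l j k hjl.symm hkl.symm hjk (by simp) (by simp)]
    ring

end Gluing

section Frame

/-- The vectors from the barycenter of a tetrahedron to its vertices, together with the gradients
of the barycentric coordinates. -/
structure IsFrame (e a : Fin 4 → V3) : Prop where
  sum_eq_zero : ∑ k, e k = 0
  dual : ∀ k l, a k ⬝ᵥ e l = (if k = l then 1 else 0) - 1 / 4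
  eq_zero : ∀ v : V3, (∀ k, v ⬝ᵥ e k = 0) → v = 0

variable {e a : Fin 4 → V3}

/-- The barycentric coordinate `k`, as a linear form relative to the barycenter. -/
def linForm (a : Fin 4 → V3) (k : Fin 4) : P3 := ∑ c, C (a k c) * X c

theorem totalDegree_C_mul_X_le {σ : Type*} (r : ℝ) (c : σ) :
    (C r * X c : MvPolynomial σ ℝ).totalDegree ≤ 1 :=
  (isHomogeneous_C_mul_X r c).totalDegree_le

theorem IsFrame.eval_linForm_sub (h : IsFrame e a) (t : Fin 4 → ℝ) (k i : Fin 4) :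
    eval (∑ l, t l • e l) (linForm a k - linForm a i) = t k - t i := by
  have : ∀ k, eval (∑ l, t l • e l) (linForm a k) = a k ⬝ᵥ ∑ l, t l • e l := by
    intro k
    simp [linForm, dotProduct]
  rw [map_sub, this, this, dotProduct_sum, dotProduct_sum, ← Finset.sum_sub_distrib]
  simp only [dotProduct_smul, h.dual, smul_eq_mul, mul_sub, mul_ite, mul_one, mul_zero,
    Finset.sum_sub_distrib]
  simp

theorem IsFrame.eval_pderiv_aeval (h : IsFrame e a) (Θ : MvPolynomial (Fin 4) ℝ) (i : Fin 4)
    (t : Fin 4 → ℝ) (hi : t i = 0) (c : Fin 3) :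
    eval (∑ l, t l • e l) (pderiv c (aeval (fun k => linForm a k - linForm a i) Θ)) =
      ∑ k, eval t (pderiv k Θ) * a k c - eval t (∑ k, pderiv k Θ) * a i c := by
  have hev : ∀ f : MvPolynomial (Fin 4) ℝ,
      eval (∑ l, t l • e l) (aeval (fun k => linForm a k - linForm a i) f) = eval t f := by
    intro f
    induction f using MvPolynomial.induction_on with
    | C r => simp
    | add f₁ f₂ h₁ h₂ => rw [map_add, map_add, map_add, h₁, h₂]
    | mul_X f k ih => rw [map_mul, map_mul, map_mul, ih, aeval_X, h.eval_linForm_sub, hi, eval_X,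
        sub_zero]
  have hd : ∀ k, pderiv c (linForm a k) = C (a k c) := by
    intro k
    simp [linForm, pderiv_X, Pi.single_apply]
  rw [derivation_aeval, map_sum]
  simp only [map_mul, hev, map_sub, hd, eval_C, map_sum, mul_sub, Finset.sum_sub_distrib,
    Finset.sum_mul]

/-- Piecewise fields with tangentially continuous traces become continuous after adding a piecewise
gradient of a continuous potential. -/
theorem IsFrame.exists_gradient_correction (h : IsFrame e a) (d : ℕ) (Q : Fin 4 → VP3)
    (hdeg : ∀ i, degVle (Q i) d) (hzero : ∀ i, evalV (Q i) 0 = 0)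
    (htan : ∀ i j, i ≠ j → ∀ t : Fin 4 → ℝ, t i = 0 → t j = 0 → ∀ k, k ≠ i → k ≠ j →
      (evalV (Q i) (∑ l, t l • e l) - evalV (Q j) (∑ l, t l • e l)) ⬝ᵥ e k = 0) :
    ∃ φ : Fin 4 → P3, (∀ i, (φ i).totalDegree ≤ d + 1) ∧
      ∀ i j, i ≠ j → ∀ t : Fin 4 → ℝ, t i = 0 → t j = 0 →
        evalV (Q i + pgrad (φ i)) (∑ l, t l • e l) =
          evalV (Q j + pgrad (φ j)) (∑ l, t l • e l) := by
  let V (i : Fin 4) (t : Fin 4 → ℝ) : V3 := evalV (Q i) (∑ l, t l • e l)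
  have hV : ∀ i j, i ≠ j → ∀ t : Fin 4 → ℝ, t i = 0 → t j = 0 →
      (V i t - V j t) ⬝ᵥ e i + (V i t - V j t) ⬝ᵥ e j = 0 := by
    intro i j hij t hi hj
    obtain ⟨k, l, hkl, hik, hil, hjk, hjl, huniv⟩ := exists_complement_pair hij
    have := congrArg ((V i t - V j t) ⬝ᵥ ·) h.sum_eq_zero
    simp only [dotProduct_zero, huniv] at this
    rw [Finset.sum_insert (by simp [*]), Finset.sum_insert (by simp [*]),
      Finset.sum_insert (by simp [*]), Finset.sum_singleton, dotProduct_add, dotProduct_add,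
      dotProduct_add, htan i j hij t hi hj k hik.symm hjk.symm,
      htan i j hij t hi hj l hil.symm hjl.symm] at this
    linarith
  let g (i j : Fin 4) : P3 := ∑ c, C (e i c) * (Q i c - Q j c)
  let G (i j : Fin 4) : MvPolynomial (Fin 4) ℝ :=
    aeval (fun c => ∑ l, C (e l c) * X l) (g i j)
  have hG : ∀ i j t, eval t (G i j) = (V i t - V j t) ⬝ᵥ e i := by
    intro i j t
    have hev : ∀ f : P3, eval t (aeval (fun c => ∑ l, C (e l c) * X l) f) =
        eval (∑ l, t l • e l) f := by
      intro f
      induction f using MvPolynomial.induction_on with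
      | C r => simp
      | add f₁ f₂ h₁ h₂ => rw [map_add, map_add, map_add, h₁, h₂]
      | mul_X f k ih =>
        rw [map_mul, map_mul, map_mul, ih, aeval_X]
        simp [mul_comm (e _ _)]
    simp only [G, hev, g, map_sum, map_mul, map_sub, eval_C, V, evalV, dotProduct, Pi.sub_apply]
    exact Finset.sum_congr rfl fun c _ => mul_comm _ _
  have hsymm : ∀ i j, i ≠ j → ∀ t : Fin 4 → ℝ, t i = 0 → t j = 0 →
      eval t (G i j) = eval t (G j i) := by
    intro i j hij t hi hj
    have := hV i j hij t hi hj
    rw [hG, hG]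
    simp only [sub_dotProduct] at this ⊢
    linarith
  obtain ⟨Ψ, hΨdeg, hΨ⟩ := exists_glued d G
    (by
      intro i j
      refine (totalDegree_aeval_le _ (fun c => totalDegree_finsetSum_le fun l _ =>
        totalDegree_C_mul_X_le _ _) _).trans (totalDegree_finsetSum_le fun c _ => ?_)
      refine (totalDegree_mul _ _).trans ?_
      rw [totalDegree_C, zero_add]
      exact (totalDegree_sub _ _).trans (max_le (hdeg i c) (hdeg j c)))
    hsymm
    (by
      intro k r
      have hs : ∀ i, i ≠ k → (Pi.single k r : Fin 4 → ℝ) i = 0 :=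
        fun i hi => Pi.single_eq_of_ne hi _
      have hstep : ∀ i j l, i ≠ k → j ≠ k → l ≠ k → i ≠ j → i ≠ l → j ≠ l →
          eval (Pi.single k r) (G i j) = eval (Pi.single k r) (G i l) := by
        intro i j l hi hj hl hij hil hjl
        have := htan j l hjl _ (hs j hj) (hs l hl) i hij hil
        rw [hG, hG]
        simp only [sub_dotProduct] at this ⊢
        simp only [V]
        linarith
      have hswap : ∀ i j, i ≠ k → j ≠ k → i ≠ j →
          eval (Pi.single k r) (G i j) = eval (Pi.single k r) (G j i) :=
        fun i j hi hj hij => hsymm i j hij _ (hs i hi) (hs j hj)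
      have hfirst : ∀ i j l, i ≠ k → j ≠ k → l ≠ k → i ≠ j → i ≠ l →
          eval (Pi.single k r) (G i j) = eval (Pi.single k r) (G i l) := by
        intro i j l hi hj hl hij hil
        by_cases hjl : j = l
        · rw [hjl]
        · exact hstep i j l hi hj hl hij hil hjl
      intro i j i' j' hi hj hi' hj' hij hij'
      by_cases hii : i = i'
      · subst hii
        exact hfirst i j j' hi hj hj' hij hij'
      · rw [hfirst i j i' hi hj hi' hij hii, hswap i i' hi hi' hii,
          hfirst i' i j' hi' hi hj' (Ne.symm hii) hij'])
    (by
      intro i j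
      rw [hG]
      simp [V, hzero])
  obtain ⟨Θ, hΘdeg, hΘ⟩ := exists_sum_pderiv_eq 0 d Ψ 0 hΨdeg
  rw [pow_zero, one_mul] at hΘ
  refine ⟨fun i => aeval (fun k => linForm a k - linForm a i) Θ, fun i => ?_, ?_⟩
  · have hlin : ∀ k, (linForm a k).totalDegree ≤ 1 := fun k =>
      totalDegree_finsetSum_le fun c _ => totalDegree_C_mul_X_le _ _
    exact (totalDegree_aeval_le _ (fun k => (totalDegree_sub _ _).trans
      (max_le (hlin k) (hlin i))) Θ).trans hΘdeg
  · intro i j hij t hi hj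
    have hjump : V i t - V j t - eval t Ψ • (a i - a j) = 0 := by
      refine h.eq_zero _ fun k => ?_
      rw [sub_dotProduct, smul_dotProduct, sub_dotProduct (a i), h.dual, h.dual,
        hΨ i j hij t hi hj, hG]
      by_cases hki : i = k
      · subst hki; simp [hij.symm]
      by_cases hkj : j = k
      · subst hkj
        have := hV i j hij t hi hj
        simp only [if_neg hij, if_true, smul_eq_mul]
        linarith
      · rw [if_neg hki, if_neg hkj]
        simpa using htan i j hij t hi hj k (Ne.symm hki) (Ne.symm hkj)
    funext c
    have hc := congrFun hjump c
    simp only [V, Pi.sub_apply, Pi.smul_apply, Pi.zero_apply, smul_eq_mul, evalV] at hc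
    simp only [evalV, Pi.add_apply, map_add, pgrad]
    rw [h.eval_pderiv_aeval Θ i t hi, h.eval_pderiv_aeval Θ j t hj, hΘ]
    linarith

end Frame

section Translation

/-- Translation of polynomials by `z`. -/
def shift (z : V3) : P3 →ₐ[ℝ] P3 := aeval fun c => X c + C (z c)

theorem eval_shift (z w : V3) (f : P3) : eval w (shift z f) = eval (w + z) f := by
  unfold shift
  induction f using MvPolynomial.induction_on with
  | C r => simp
  | add f₁ f₂ h₁ h₂ => rw [map_add, map_add, map_add, h₁, h₂]
  | mul_X f c ih => rw [map_mul, map_mul, map_mul, ih, aeval_X]; simp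

theorem evalV_shift (z w : V3) (q : VP3) :
    evalV (fun c => shift z (q c)) w = evalV q (w + z) :=
  funext fun c => eval_shift z w (q c)

theorem totalDegree_shift_le (z : V3) (f : P3) : (shift z f).totalDegree ≤ f.totalDegree :=
  totalDegree_aeval_le _ (fun c => (totalDegree_add _ _).trans (by simp)) f

theorem pderiv_shift (z : V3) (c : Fin 3) (f : P3) :
    pderiv c (shift z f) = shift z (pderiv c f) := by
  rw [shift, derivation_aeval, Finset.sum_eq_single c]
  · simp
  · intro b _ hb
    simp [pderiv_X, Pi.single_eq_of_ne hb]
  · simp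

theorem shift_neg_shift (z : V3) (f : P3) : shift (-z) (shift z f) = f :=
  MvPolynomial.funext fun w => by simp [eval_shift]

end Translation

section Curl

theorem pcurl_pgrad (φ : P3) : pcurl (pgrad φ) = 0 :=
  funext fun c => sub_eq_zero.2 (pderiv_pderiv_comm (c + 1) (c + 2) φ)

theorem pcurl_add (q q' : VP3) : pcurl (q + q') = pcurl q + pcurl q' := by
  funext c
  simp only [pcurl, Pi.add_apply, map_add]
  ring

theorem pcurl_shift (z : V3) (q : VP3) :
    pcurl (fun c => shift z (q c)) = fun c => shift z (pcurl q c) := by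
  funext c
  simp only [pcurl, pderiv_shift, map_sub]

theorem pdiv_shift (z : V3) (q : VP3) : pdiv (fun c => shift z (q c)) = shift z (pdiv q) := by
  simp only [pdiv, pderiv_shift, map_sum]

end Curl

section Geometry

variable {x : Fin 4 → V3}

theorem exists_isFrame (hx : AffineIndependent ℝ x) :
    ∃ a, IsFrame (fun k => x k - bary x) a := by
  let b : AffineBasis (Fin 4) ℝ V3 :=
    ⟨x, hx, (hx.affineSpan_eq_top_iff_card_eq_finrank_add_one).2 (by simp)⟩
  let a (k : Fin 4) : V3 := fun c => (b.coord k).linear (Pi.single c 1)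
  have ha : ∀ k v, a k ⬝ᵥ v = (b.coord k).linear v := by
    intro k v
    conv_rhs => rw [pi_eq_sum_univ' v, map_sum]
    refine Finset.sum_congr rfl fun c _ => ?_
    rw [map_smul, smul_eq_mul, mul_comm]
  have hsum : ∑ k, (x k - bary x) = 0 := by
    simp only [bary, Fin.sum_univ_four]
    module
  have hbx : ∀ k l, b.coord k (x l) = if k = l then 1 else 0 := b.coord_apply
  have hlin : ∀ k l m, (b.coord k).linear (x l - x m) =
      (if k = l then 1 else 0) - if k = m then 1 else 0 := by
    intro k l m
    rw [← hbx, ← hbx, ← vsub_eq_sub, AffineMap.linearMap_vsub, vsub_eq_sub]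
  have hbary : ∀ l, x l - bary x = (4 : ℝ)⁻¹ • ∑ m, (x l - x m) := by
    intro l
    simp only [bary, Fin.sum_univ_four]
    module
  refine ⟨a, hsum, fun k l => ?_, fun v hv => ?_⟩
  · rw [ha, hbary, map_smul, map_sum]
    simp only [hlin, Finset.sum_sub_distrib]
    simp
    split_ifs <;> ring
  · have hv' : ∀ k, v ⬝ᵥ x k = v ⬝ᵥ bary x := fun k => by
      have := hv k
      rwa [dotProduct_sub, sub_eq_zero] at this
    have hconst : ∀ w, v ⬝ᵥ w = v ⬝ᵥ bary x := by
      intro w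
      conv_lhs => rw [← b.linear_combination_coord_eq_self w]
      rw [dotProduct_sum]
      have : ∀ k, v ⬝ᵥ b.coord k w • b k = b.coord k w * v ⬝ᵥ bary x := fun k => by
        rw [dotProduct_smul, smul_eq_mul]
        exact congrArg _ (hv' k)
      rw [Finset.sum_congr rfl fun k _ => this k, ← Finset.sum_mul, b.sum_coord_apply_eq_one,
        one_mul]
    have h0 := hconst 0
    rw [dotProduct_zero, ← hconst v] at h0
    exact dotProduct_self_eq_zero.1 h0.symm

theorem sum_eq_of_complement {i j k l : Fin 4} (hkl : k ≠ l) (hik : i ≠ k) (hil : i ≠ l)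
    (hjk : j ≠ k) (hjl : j ≠ l) (hij : i ≠ j)
    (huniv : (Finset.univ : Finset (Fin 4)) = {i, j, k, l}) {t : Fin 4 → ℝ} (hi : t i = 0)
    (hj : t j = 0) (e : Fin 4 → V3) : ∑ m, t m • e m = t k • e k + t l • e l := by
  rw [huniv, Finset.sum_insert (by simp [*]), Finset.sum_insert (by simp [*]),
    Finset.sum_insert (by simp [*]), Finset.sum_singleton, hi, hj]
  simp

/-- A polynomial vanishing on an interior face vanishes on the plane of the face. -/
theorem eval_plane_eq_zero {i j : Fin 4} (hij : i ≠ j) {f : P3}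
    (hf : ∀ y ∈ intFace x i j, eval y f = 0) {t : Fin 4 → ℝ} (hi : t i = 0) (hj : t j = 0) :
    eval (bary x + ∑ l, t l • (x l - bary x)) f = 0 := by
  obtain ⟨k, l, hkl, hik, hil, hjk, hjl, huniv⟩ := exists_complement_pair hij
  rw [sum_eq_of_complement hkl hik hil hjk hjl hij huniv hi hj]
  have hmem : ∀ u v : ℝ, 0 ≤ u → 0 ≤ v → u + v ≤ 1 →
      bary x + (u • (x k - bary x) + v • (x l - bary x)) ∈ intFace x i j := by
    intro u v hu hv huv
    have hk : x k ∈ intFace x i j := subset_convexHull _ _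
      (Set.mem_insert_of_mem _ ⟨k, ⟨hik.symm, hjk.symm⟩, rfl⟩)
    have hl : x l ∈ intFace x i j := subset_convexHull _ _
      (Set.mem_insert_of_mem _ ⟨l, ⟨hil.symm, hjl.symm⟩, rfl⟩)
    have hz : bary x ∈ intFace x i j := subset_convexHull _ _ (Set.mem_insert _ _)
    have := (convex_convexHull ℝ _ : Convex ℝ (intFace x i j)).sum_mem (t := Finset.univ)
      (w := ![1 - u - v, u, v]) (z := ![bary x, x k, x l])
      (by intro m _; fin_cases m <;> simp <;> linarith)
      (by
        simp [Fin.sum_univ_three]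
        ring)
      (by intro m _; fin_cases m; exacts [hz, hk, hl])
    have hsum : ∑ m, (![1 - u - v, u, v] : Fin 3 → ℝ) m • (![bary x, x k, x l] : Fin 3 → V3) m =
        bary x + (u • (x k - bary x) + v • (x l - bary x)) := by
      simp only [Fin.sum_univ_three, cons_val]
      module
    rwa [hsum] at this
  set M : ℝ := 1 + |t k| + |t l| with hM
  have hMpos : 0 < M := by positivity
  have hline := eval_line_eq_zero (f := f)
    (a := bary x + ((1 / 3 : ℝ) • (x k - bary x) + (1 / 3 : ℝ) • (x l - bary x)))
    (v := (t k - 1 / 3) • (x k - bary x) + (t l - 1 / 3) • (x l - bary x))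
    (S := Set.Icc 0 (1 / (3 * M))) (Set.Icc_infinite (by positivity))
    (fun τ hτ => ?_) 1
  · rw [← hline]
    congr 2
    module
  · have hτM : τ * M ≤ 1 / 3 := by
      have := hτ.2
      rw [le_div_iff₀ (by positivity)] at this
      linarith
    have h1 := mul_nonneg hτ.1 (neg_le_iff_add_nonneg.1 (neg_abs_le (t k)))
    have h2 := mul_nonneg hτ.1 (neg_le_iff_add_nonneg.1 (neg_abs_le (t l)))
    have h3 := mul_nonneg hτ.1 (sub_nonneg.2 (le_abs_self (t k)))
    have h4 := mul_nonneg hτ.1 (sub_nonneg.2 (le_abs_self (t l)))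
    have h5 := mul_nonneg hτ.1 (abs_nonneg (t k))
    have h6 := mul_nonneg hτ.1 (abs_nonneg (t l))
    have h7 := hτ.1
    have := hf _ (hmem (1 / 3 + τ * (t k - 1 / 3)) (1 / 3 + τ * (t l - 1 / 3))
      (by nlinarith) (by nlinarith) (by nlinarith))
    rw [← this]
    congr 2
    module

theorem exists_coords_of_mem_intFace {i j : Fin 4} {y : V3} (hy : y ∈ intFace x i j) :
    ∃ t : Fin 4 → ℝ, t i = 0 ∧ t j = 0 ∧ y = bary x + ∑ l, t l • (x l - bary x) := by
  refine convexHull_min (t := {y | ∃ t : Fin 4 → ℝ, t i = 0 ∧ t j = 0 ∧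
    y = bary x + ∑ l, t l • (x l - bary x)}) ?_ ?_ hy
  · rintro _ (rfl | ⟨k, ⟨hki, hkj⟩, rfl⟩)
    · exact ⟨0, by simp⟩
    · exact ⟨Pi.single k 1, Pi.single_eq_of_ne hki.symm _, Pi.single_eq_of_ne hkj.symm _,
        by simp [Pi.single_apply]⟩
  · rintro _ ⟨t, hi, hj, rfl⟩ _ ⟨t', hi', hj', rfl⟩ r r' _ _ hr
    refine ⟨r • t + r' • t', by simp [hi, hi'], by simp [hj, hj'], ?_⟩
    obtain rfl : r' = 1 - r := by linarith
    simp only [Pi.add_apply, Pi.smul_apply, Fin.sum_univ_four, smul_eq_mul]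
    module

theorem vertex_mem_piece {m i : Fin 4} (h : m ≠ i) : x m ∈ piece x i :=
  subset_convexHull _ _ (Set.mem_insert_of_mem _ ⟨m, h, rfl⟩)

theorem bary_mem_piece (i : Fin 4) : bary x ∈ piece x i :=
  subset_convexHull _ _ (Set.mem_insert _ _)

theorem vertex_notMem_piece (hx : AffineIndependent ℝ x) (m : Fin 4) : x m ∉ piece x m := by
  obtain ⟨a, ha⟩ := exists_isFrame hx
  intro hm
  obtain ⟨i, hi⟩ := exists_ne m
  have hsub : piece x m ⊆ {y | (a m - a i) ⬝ᵥ y ≤ (a m - a i) ⬝ᵥ bary x} := by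
    refine convexHull_min ?_ (convex_halfSpace_le ⟨fun y y' => dotProduct_add _ _ _,
      fun r y => dotProduct_smul _ _ _⟩ _)
    rintro _ (rfl | ⟨k, hk, rfl⟩)
    · exact le_refl ((a m - a i) ⬝ᵥ bary x)
    · rw [Set.mem_ofPred_eq, ← sub_nonpos, ← dotProduct_sub, sub_dotProduct, ha.dual, ha.dual,
        if_neg (Ne.symm hk)]
      split_ifs <;> norm_num
  have := hsub hm
  rw [Set.mem_ofPred_eq, ← sub_nonpos, ← dotProduct_sub, sub_dotProduct, ha.dual, ha.dual,
    if_pos rfl, if_neg hi] at this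
  norm_num at this

/-- A vertex shared by two pieces is shared by three. -/
theorem exists_third_piece (hx : AffineIndependent ℝ x) {y : V3} (hy : y ∈ vertices x)
    {i j : Fin 4} (hij : i ≠ j) (hi : y ∈ piece x i) (hj : y ∈ piece x j) :
    ∃ (l : Fin 4) (t : Fin 4 → ℝ), l ≠ i ∧ l ≠ j ∧ y ∈ piece x l ∧ t i = 0 ∧ t j = 0 ∧ t l = 0 ∧
      y = bary x + ∑ k, t k • (x k - bary x) := by
  obtain ⟨k, l, hkl, hik, hil, hjk, hjl, huniv⟩ := exists_complement_pair hij
  rcases hy with rfl | ⟨m, rfl⟩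
  · exact ⟨l, 0, hil.symm, hjl.symm, bary_mem_piece l, by simp⟩
  · have him : m ≠ i := fun h => vertex_notMem_piece hx m (h ▸ hi)
    have hjm : m ≠ j := fun h => vertex_notMem_piece hx m (h ▸ hj)
    have hcoord : x m = bary x + ∑ k, (Pi.single m (1 : ℝ) : Fin 4 → ℝ) k • (x k - bary x) := by
      simp [Pi.single_apply]
    by_cases hml : m = l
    · subst hml
      exact ⟨k, Pi.single m 1, hik.symm, hjk.symm, vertex_mem_piece hkl.symm,
        Pi.single_eq_of_ne him.symm _, Pi.single_eq_of_ne hjm.symm _,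
        Pi.single_eq_of_ne hkl _, hcoord⟩
    · exact ⟨l, Pi.single m 1, hil.symm, hjl.symm, vertex_mem_piece hml,
        Pi.single_eq_of_ne him.symm _, Pi.single_eq_of_ne hjm.symm _,
        Pi.single_eq_of_ne (Ne.symm hml) _, hcoord⟩

/-- Normal continuity extends from an interior face to its plane, and to normals of any length. -/
theorem normal_jump_eq_zero {p : Fin 4 → VP3}
    (hnormInt : ∀ i j, i ≠ j → ∀ n, IsUnitNormalInt x i j n →
      ∀ y ∈ intFace x i j, (evalV (p i) y - evalV (p j) y) ⬝ᵥ n = 0)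
    {i j : Fin 4} (hij : i ≠ j) {n : V3} (hn : ∀ k, k ≠ i → k ≠ j → n ⬝ᵥ (x k - bary x) = 0)
    {t : Fin 4 → ℝ} (hi : t i = 0) (hj : t j = 0) :
    (evalV (p i) (bary x + ∑ l, t l • (x l - bary x)) -
      evalV (p j) (bary x + ∑ l, t l • (x l - bary x))) ⬝ᵥ n = 0 := by
  have heval : ∀ y, eval y (∑ c, (p i c - p j c) * C (n c)) =
      (evalV (p i) y - evalV (p j) y) ⬝ᵥ n := by
    intro y
    simp [dotProduct, evalV]
  rw [← heval]
  refine eval_plane_eq_zero hij (fun y hy => ?_) hi hj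
  rw [heval]
  by_cases h0 : n ⬝ᵥ n = 0
  · rw [dotProduct_self_eq_zero.1 h0, dotProduct_zero]
  · have hpos : 0 < n ⬝ᵥ n := lt_of_le_of_ne
      (Finset.sum_nonneg fun c _ => mul_self_nonneg (n c)) (Ne.symm h0)
    have hs : √(n ⬝ᵥ n) ≠ 0 := (Real.sqrt_pos.2 hpos).ne'
    have hunit := hnormInt i j hij ((√(n ⬝ᵥ n))⁻¹ • n) ⟨?_, fun k hki hkj => ?_⟩ y hy
    · rw [dotProduct_smul, smul_eq_mul] at hunit
      exact (mul_eq_zero.1 hunit).resolve_left (inv_ne_zero hs)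
    · rw [smul_dotProduct, dotProduct_smul, smul_eq_mul, smul_eq_mul, ← mul_assoc, ← mul_inv,
        Real.mul_self_sqrt hpos.le, inv_mul_cancel₀ h0]
    · rw [smul_dotProduct, hn k hki hkj, smul_zero]

end Geometry

section Supersmoothness

variable {e a : Fin 4 → V3}

/-- Around an edge shared by three pieces, symmetric rank one jumps of the Jacobian vanish. -/
theorem IsFrame.jump_eq_zero (h : IsFrame e a) (J : Fin 4 → Matrix (Fin 3) (Fin 3) ℝ)
    {i j l : Fin 4} (hij : i ≠ j) (hli : l ≠ i) (hlj : l ≠ j)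
    (hsymm : ∀ r ∈ ({i, j, l} : Set (Fin 4)), ∀ r' ∈ ({i, j, l} : Set (Fin 4)),
      (J r - J r')ᵀ = J r - J r')
    (hker : ∀ r ∈ ({i, j, l} : Set (Fin 4)), ∀ r' ∈ ({i, j, l} : Set (Fin 4)), r ≠ r' →
      ∀ k, k ≠ r → k ≠ r' → (J r - J r') *ᵥ e k = 0) :
    J i = J j := by
  have hi : i ∈ ({i, j, l} : Set (Fin 4)) := by simp
  have hj : j ∈ ({i, j, l} : Set (Fin 4)) := by simp
  have hl : l ∈ ({i, j, l} : Set (Fin 4)) := by simp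
  have hflip : ∀ r ∈ ({i, j, l} : Set (Fin 4)), ∀ r' ∈ ({i, j, l} : Set (Fin 4)), ∀ u v,
      u ⬝ᵥ (J r - J r') *ᵥ v = v ⬝ᵥ (J r - J r') *ᵥ u := by
    intro r hr r' hr' u v
    rw [dotProduct_mulVec, ← mulVec_transpose, hsymm r hr r' hr', dotProduct_comm]
  have hcross : e i ⬝ᵥ (J i - J j) *ᵥ e j = 0 := by
    have h1 : J i - J j = (J i - J l) + (J l - J j) := by abel
    rw [h1, add_mulVec, hker i hi l hl hli.symm j hij.symm hlj.symm, zero_add,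
      hflip l hl j hj, hker l hl j hj hlj i hli.symm hij, dotProduct_zero]
  have hsum : (J i - J j) *ᵥ e i + (J i - J j) *ᵥ e j = 0 := by
    obtain ⟨k, m, hkm, hik, him, hjk, hjm, huniv⟩ := exists_complement_pair hij
    have := congrArg ((J i - J j) *ᵥ ·) h.sum_eq_zero
    simp only [mulVec_zero, huniv] at this
    rwa [Finset.sum_insert (by simp [*]), Finset.sum_insert (by simp [*]),
      Finset.sum_insert (by simp [*]), Finset.sum_singleton, mulVec_add, mulVec_add, mulVec_add,
      hker i hi j hj hij k hik.symm hjk.symm, hker i hi j hj hij m him.symm hjm.symm,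
      add_zero, add_zero] at this
  have hei : (J i - J j) *ᵥ e i = 0 := by
    refine h.eq_zero _ fun m => ?_
    rw [dotProduct_comm, hflip i hi j hj]
    by_cases hmi : m = i
    · subst hmi
      rw [eq_neg_of_add_eq_zero_left hsum, dotProduct_neg, hcross, neg_zero]
    by_cases hmj : m = j
    · subst hmj
      exact hcross
    · rw [hker i hi j hj hij m hmi hmj, dotProduct_zero]
  have hall : ∀ k, (J i - J j) *ᵥ e k = 0 := by
    intro k
    by_cases hki : k = i
    · rw [hki, hei]
    by_cases hkj : k = j
    · rw [hkj]
      rwa [hei, zero_add] at hsum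
    · exact hker i hi j hj hij k hki hkj
  refine sub_eq_zero.1 (funext fun c => h.eq_zero _ fun k => ?_)
  exact congrFun (hall k) c

theorem jacob_sub_transpose {q q' : VP3} {y : V3}
    (h : evalV (pcurl q) y = evalV (pcurl q') y) :
    (of (jacob q y) - of (jacob q' y))ᵀ = of (jacob q y) - of (jacob q' y) := by
  have h0 := congrFun h 0
  have h1 := congrFun h 1
  have h2 := congrFun h 2
  simp only [evalV, pcurl, map_sub] at h0 h1 h2
  simp only [zero_add, show (1 : Fin 3) + 1 = 2 from rfl, show (1 : Fin 3) + 2 = 0 from rfl,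
    show (2 : Fin 3) + 1 = 0 from rfl, show (2 : Fin 3) + 2 = 1 from rfl] at h0 h1 h2
  ext c d
  fin_cases c <;> fin_cases d <;> simp [jacob] <;> linarith

theorem jacob_sub_mulVec {q q' : VP3} {y v : V3}
    (h : ∀ τ : ℝ, evalV q (y + τ • v) = evalV q' (y + τ • v)) :
    (of (jacob q y) - of (jacob q' y)) *ᵥ v = 0 := by
  funext c
  have := sum_eval_pderiv_mul_eq_zero (f := q c - q' c) (a := y) (v := v) fun τ => by
    rw [map_sub, sub_eq_zero]
    exact congrFun (h τ) c
  simpa [mulVec, dotProduct, jacob] using this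

end Supersmoothness

/-- Existence of continuous piecewise vector potentials, relative to the barycenter. -/
theorem IsFrame.exists_continuous_potential {e a : Fin 4 → V3} (h : IsFrame e a) (s : ℕ)
    (p : Fin 4 → VP3) (hdeg : ∀ i, degVle (p i) s) (hdiv : ∀ i, pdiv (p i) = 0)
    (hnormal : ∀ i j, i ≠ j → ∀ n : V3, (∀ k, k ≠ i → k ≠ j → n ⬝ᵥ e k = 0) →
      ∀ t : Fin 4 → ℝ, t i = 0 → t j = 0 →
        (evalV (p i) (∑ l, t l • e l) - evalV (p j) (∑ l, t l • e l)) ⬝ᵥ n = 0) :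
    ∃ q : Fin 4 → VP3, (∀ i, degVle (q i) (s + 1)) ∧ (∀ i, pcurl (q i) = p i) ∧
      ∀ i j, i ≠ j → ∀ t : Fin 4 → ℝ, t i = 0 → t j = 0 →
        evalV (q i) (∑ l, t l • e l) = evalV (q j) (∑ l, t l • e l) := by
  obtain ⟨φ, hφ, hq⟩ := h.exists_gradient_correction (s + 1) (fun i => potential s (p i))
    (fun i => degVle_potential s (p i))
    (fun i => by funext c; simp [evalV, potential, pcross])
    (fun i j hij t hi hj k hki hkj => by
      refine potential_sub_dotProduct s _ _ _ _ fun τ => ?_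
      have hτ : τ • ∑ l, t l • e l = ∑ l, (τ • t) l • e l := by
        simp [Finset.smul_sum, smul_smul]
      rw [hτ]
      refine hnormal i j hij _ (fun m hmi hmj => ?_) _ (by simp [hi]) (by simp [hj])
      obtain ⟨k', l', hkl, hik, hil, hjk, hjl, huniv⟩ := exists_complement_pair hij
      rw [sum_eq_of_complement hkl hik hil hjk hjl hij huniv hi hj]
      have hmem : ∀ c : Fin 4, c ≠ i → c ≠ j → c = k' ∨ c = l' := by
        intro c hci hcj
        have := Finset.mem_univ c
        rw [huniv] at this
        simpa [hci, hcj] using this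
      rcases hmem k hki hkj with rfl | rfl <;> rcases hmem m hmi hmj with rfl | rfl <;>
      · simp [cross3, dotProduct, Fin.sum_univ_three]
        ring)
  refine ⟨fun i => potential s (p i) + pgrad (φ i), fun i c => ?_, fun i => ?_, hq⟩
  · refine (totalDegree_add _ _).trans (max_le (degVle_potential s (p i) c) ?_)
    exact (totalDegree_pderiv_le c (φ i)).trans (Nat.sub_le_of_le_add (hφ i))
  · rw [pcurl_add, pcurl_pgrad, add_zero, pcurl_potential (hdeg i) (hdiv i)]

end Alfeld

open Alfeld

/-- divergence-free piecewise polynomial vector fields with single-valued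
normal traces on interior faces and continuous at the vertices are curls of continuous
piecewise polynomial vector fields which are `C¹` at the vertices. -/
theorem statement18 (s : ℕ) (x : Fin 4 → V3) (hx : AffineIndependent ℝ x)
    (p : Fin 4 → VP3) (hdeg : ∀ i, degVle (p i) s)
    (hnormInt : ∀ i j, i ≠ j → ∀ n, IsUnitNormalInt x i j n →
      ∀ y ∈ intFace x i j, (evalV (p i) y - evalV (p j) y) ⬝ᵥ n = 0)
    (hvert : ∀ a ∈ vertices x, ∀ i j, a ∈ piece x i → a ∈ piece x j →
      evalV (p i) a = evalV (p j) a)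
    (hdiv : ∀ i, pdiv (p i) = 0) :
    ∃ q : Fin 4 → VP3,
      (∀ i, degVle (q i) (s + 1)) ∧
      (∀ i j, i ≠ j → ∀ y ∈ intFace x i j, evalV (q i) y = evalV (q j) y) ∧
      (∀ a ∈ vertices x, ∀ i j, a ∈ piece x i → a ∈ piece x j →
        jacob (q i) a = jacob (q j) a) ∧
      (∀ i, pcurl (q i) = p i) := by
  obtain ⟨a, ha⟩ := exists_isFrame hx
  obtain ⟨q, hqdeg, hqcurl, hqcont⟩ := ha.exists_continuous_potential s
    (fun i c => shift (bary x) (p i c))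
    (fun i c => (totalDegree_shift_le _ _).trans (hdeg i c))
    (fun i => by rw [pdiv_shift, hdiv, map_zero])
    (fun i j hij n hn t hi hj => by
      rw [evalV_shift, evalV_shift, add_comm _ (bary x)]
      exact normal_jump_eq_zero hnormInt hij hn hi hj)
  obtain ⟨q', hdeg', hcurl, hcont⟩ : ∃ q' : Fin 4 → VP3, (∀ i, degVle (q' i) (s + 1)) ∧
      (∀ i, pcurl (q' i) = p i) ∧ ∀ i j, i ≠ j → ∀ t : Fin 4 → ℝ, t i = 0 → t j = 0 →
        evalV (q' i) (bary x + ∑ l, t l • (x l - bary x)) =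
          evalV (q' j) (bary x + ∑ l, t l • (x l - bary x)) := by
    refine ⟨fun i c => shift (-bary x) (q i c),
      fun i c => (totalDegree_shift_le _ _).trans (hqdeg i c), fun i => ?_,
      fun i j hij t hi hj => ?_⟩
    · rw [pcurl_shift, hqcurl]
      simp only [shift_neg_shift]
    · rw [evalV_shift, evalV_shift, add_neg_cancel_comm]
      exact hqcont i j hij t hi hj
  refine ⟨q', hdeg', fun i j hij y hy => ?_, fun y hy i j hi hj => ?_, hcurl⟩
  · obtain ⟨t, hti, htj, rfl⟩ := exists_coords_of_mem_intFace hy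
    exact hcont i j hij t hti htj
  · by_cases hij : i = j
    · rw [hij]
    obtain ⟨l, t, hli, hlj, hl, hti, htj, htl, hyt⟩ := exists_third_piece hx hy hij hi hj
    have hpiece : ∀ r ∈ ({i, j, l} : Set (Fin 4)), y ∈ piece x r ∧ t r = 0 := by
      rintro r (rfl | rfl | rfl)
      exacts [⟨hi, hti⟩, ⟨hj, htj⟩, ⟨hl, htl⟩]
    refine ha.jump_eq_zero (fun r => of (jacob (q' r) y)) hij hli hlj
      (fun r hr r' hr' => jacob_sub_transpose ?_)
      (fun r hr r' hr' hrr k hkr hkr' => jacob_sub_mulVec fun τ => ?_)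
    · rw [hcurl, hcurl]
      exact hvert y hy r r' (hpiece r hr).1 (hpiece r' hr').1
    · have hτ : y + τ • (x k - bary x) =
          bary x + ∑ m, (t + Pi.single k τ : Fin 4 → ℝ) m • (x m - bary x) := by
        rw [hyt]
        simp [add_smul, Finset.sum_add_distrib, Pi.single_apply, add_assoc]
      rw [hτ]
      exact hcont r r' hrr _ (by simp [(hpiece r hr).2, hkr.symm])
        (by simp [(hpiece r' hr').2, hkr'.symm])
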